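/- Let t, L, m ≥ 1 be integers with m > 2L. Then there exists a set S ⊆ (ℝ^t)^m which is dense in the euclidean topology of (ℝ^t)^m and has the following property (universality): for every γ = (γ_1,…,γ_m) ∈ S, every ℚ-constructible set D ⊆ ℂ^L, every integer Δ ≥ 0 and every family (Ω_α)_{|α|≤Δ} of polynomials in ℚ[Z_1,…,Z_L] indexed by exponent vectors α ∈ ℕ^t with |α| ≤ Δ, setting Q_c := Σ_{|α|≤Δ} Ω_α(c)·Y^α and O := {Q_c : c ∈ D}, any two polynomials F_1, F_2 in the Zariski closure Ō of O (taken in the coefficient space of polynomials of total degree at most Δ in Y_1,…,Y_t) with F_1(γ_i) = F_2(γ_i) for all 1 ≤ i ≤ m satisfy F_1 = F_2; that is, every γ ∈ S is an identification sequence for the Zariski closure of every ℚ-constructible object class of t-variate polynomial functions admitting a ℚ-definable holomorphic encoding by a data structure of size L. -/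

import Mathlib

open scoped BigOperators

/-- A subset of `ℂ^ι` is Zariski closed if it is the common zero set of a family
of polynomials with complex coefficients. -/
def ZariskiClosed {ι : Type} (S : Set (ι → ℂ)) : Prop :=
  ∃ F : Set (MvPolynomial ι ℂ), S = {x : ι → ℂ | ∀ f ∈ F, MvPolynomial.eval x f = 0}

/-- The Zariski closure of a set: the intersection of all Zariski closed sets
containing it. -/
def zClosure {ι : Type} (S : Set (ι → ℂ)) : Set (ι → ℂ) :=
  ⋂₀ {C : Set (ι → ℂ) | ZariskiClosed C ∧ S ⊆ C}

/-- Membership in the Boolean algebra of sets generated by a family `G`. -/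
inductive InBoolAlg {α : Type*} (G : Set (Set α)) : Set α → Prop
  | basic (s : Set α) : s ∈ G → InBoolAlg G s
  | univ : InBoolAlg G Set.univ
  | compl (s : Set α) : InBoolAlg G s → InBoolAlg G sᶜ
  | inter (s u : Set α) : InBoolAlg G s → InBoolAlg G u → InBoolAlg G (s ∩ u)

/-- Evaluation of a coefficient vector (indexed by exponent vectors
`α : Fin t → Fin (Δ+1)`) at a point `y ∈ ℂ^t`: the value of the corresponding
polynomial `Σ_α v_α · y^α`. -/
noncomputable def evalVec {t Δ : ℕ} (v : (Fin t → Fin (Δ + 1)) → ℂ) (y : Fin t → ℂ) : ℂ :=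
  ∑ α : Fin t → Fin (Δ + 1), v α * ∏ i : Fin t, y i ^ (α i : ℕ)

/-- The object class `O = {Q_c : c ∈ D}`, where `Q_c` is the coefficient vector
`α ↦ Ω_α(c)`. -/
def objClass (t L Δ : ℕ) (D : Set (Fin L → ℂ))
    (Ω : (Fin t → Fin (Δ + 1)) → MvPolynomial (Fin L) ℚ) :
    Set ((Fin t → Fin (Δ + 1)) → ℂ) :=
  {v | ∃ c ∈ D, v = fun α => MvPolynomial.aeval c (Ω α)}

open AlgebraicIndependent in
theorem aux_rank (t L Δ : ℕ) (D : Set (Fin L → ℂ))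
    (Ω : (Fin t → Fin (Δ + 1)) → MvPolynomial (Fin L) ℚ)
    (v : (Fin t → Fin (Δ + 1)) → ℂ) (hv : v ∈ zClosure (objClass t L Δ D Ω)) :
    (matroid ℚ ℂ).eRk (Set.range v) ≤ (L : ℕ∞) := by
  rw [Matroid.eRk_le_iff]
  intro I hI hind
  choose a ha using fun x : I => hI x.2
  rw [matroid_indep_iff] at hind
  have h1 : AlgebraicIndependent ℚ (fun x : I => Ω (a x)) := by
    rw [algebraicIndependent_iff]
    intro p hp
    have h2 : MvPolynomial.eval v
        (MvPolynomial.map (algebraMap ℚ ℂ) (MvPolynomial.rename a p)) = 0 := by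
      have := hv {x | ∀ f ∈ ({MvPolynomial.map (algebraMap ℚ ℂ) (MvPolynomial.rename a p)} :
        Set (MvPolynomial _ ℂ)), MvPolynomial.eval x f = 0} ⟨⟨_, rfl⟩, ?_⟩
      · exact this _ rfl
      · rintro _ ⟨c, -, rfl⟩ f hf
        rw [Set.mem_singleton_iff.1 hf, MvPolynomial.eval_map, ← MvPolynomial.aeval_def,
          MvPolynomial.aeval_rename]
        have h3 := congrArg (MvPolynomial.aeval c) hp
        rw [← AlgHom.comp_apply, MvPolynomial.comp_aeval, map_zero] at h3
        exact h3
    rw [MvPolynomial.eval_map, ← MvPolynomial.aeval_def, MvPolynomial.aeval_rename] at h2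
    refine (algebraicIndependent_iff.1 hind) p ?_
    rw [← h2]
    congr 2
    funext x
    exact (ha x).symm
  have h4 := h1.lift_cardinalMk_le_trdeg
  rw [MvPolynomial.trdeg_of_isDomain] at h4
  simp only [Cardinal.lift_id, Cardinal.mk_fin] at h4
  have hf : I.Finite := Cardinal.lt_aleph0_iff_set_finite.1 (h4.trans_lt (Cardinal.natCast_lt_aleph0))
  rw [← hf.cast_ncard_eq, ← Set.cast_ncard hf] at *
  exact_mod_cast h4

open AlgebraicIndependent in
theorem aux_dep (t Δ : ℕ) (v : (Fin t → Fin (Δ + 1)) → ℂ) (hv : v ≠ 0) (y : Fin t → ℂ)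
    (hy : Function.Injective y) (h0 : evalVec v y = 0) (X : Set ℂ)
    (hX : ∀ a, v a ∈ Algebra.adjoin ℚ X) :
    ∃ j, y j ∈ (matroid ℚ ℂ).closure (X ∪ y '' {j}ᶜ) := by
  obtain ⟨a₀, ha₀⟩ := Function.ne_iff.1 hv
  let e : (Fin t → Fin (Δ + 1)) → (Fin t →₀ ℕ) :=
    fun a => Finsupp.equivFunOnFinite.symm fun i => (a i : ℕ)
  have he : Function.Injective e := by
    intro a b h
    have := Finsupp.equivFunOnFinite.symm.injective h
    funext i
    exact Fin.ext (congrFun this i)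
  let P : MvPolynomial (Fin t) (Algebra.adjoin ℚ X) :=
    ∑ a, MvPolynomial.monomial (e a) ⟨v a, hX a⟩
  have hP : P ≠ 0 := by
    intro h
    have h1 := congrArg (MvPolynomial.coeff (e a₀)) h
    simp only [P, MvPolynomial.coeff_sum, MvPolynomial.coeff_monomial, he.eq_iff,
      Finset.sum_ite_eq', Finset.mem_univ, if_true, MvPolynomial.coeff_zero] at h1
    exact ha₀ (congrArg Subtype.val h1)
  have hPy : MvPolynomial.aeval y P = 0 := by
    rw [← h0]
    simp only [P, map_sum, MvPolynomial.aeval_monomial, evalVec]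
    refine Finset.sum_congr rfl fun a _ => ?_
    rw [Finsupp.prod_fintype _ _ (by simp)]
    rfl
  have hdep : ¬ (matroid (Algebra.adjoin ℚ X) ℂ).Indep (Set.range y) := by
    intro h
    have h' : AlgebraicIndependent (Algebra.adjoin ℚ X) y :=
      (algebraicIndependent_subtype_range hy).1 h
    exact hP (algebraicIndependent_iff.1 h' P hPy)
  rw [Matroid.indep_iff_forall_notMem_closure_sdiff (by simp)] at hdep
  push Not at hdep
  obtain ⟨_, ⟨j, rfl⟩, hj⟩ := hdep
  refine ⟨j, ?_⟩
  have hs : Set.range y \ {y j} = y '' {j}ᶜ := by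
    rw [Set.image_compl_eq_range_sdiff_image hy, Set.image_singleton]
  rw [hs, matroid_closure_eq] at hj
  rw [matroid_closure_eq]
  have hj' : IsAlgebraic (Algebra.adjoin (Algebra.adjoin ℚ X) (y '' {j}ᶜ)) (y j) := hj
  show IsAlgebraic (Algebra.adjoin ℚ (X ∪ y '' {j}ᶜ)) (y j)
  rw [Algebra.adjoin_union_eq_adjoin_adjoin]
  exact hj'

theorem aux_dense (σ : Type) [Fintype σ] :
    Dense {γ : σ → ℝ | AlgebraicIndependent ℚ γ} := by
  have h : {γ : σ → ℝ | AlgebraicIndependent ℚ γ} =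
      ⋂ p : {p : MvPolynomial σ ℚ // p ≠ 0}, {γ : σ → ℝ | MvPolynomial.aeval γ p.1 ≠ 0} := by
    ext γ
    simp only [Set.mem_ofPred_eq, Set.mem_iInter, algebraicIndependent_iff, Subtype.forall]
    exact forall_congr' fun p => by tauto
  have hc : Countable (MvPolynomial σ ℚ) := by
    rw [← Cardinal.mk_le_aleph0_iff]
    refine MvPolynomial.cardinalMk_le_max.trans ?_
    simp
  rw [h]
  refine dense_iInter_of_isOpen (fun p => ?_) (fun p => ?_)
  · refine isOpen_ne_fun ?_ continuous_const
    simp only [MvPolynomial.aeval_def, MvPolynomial.eval₂_eq']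
    fun_prop
  · rw [Metric.dense_iff]
    intro x r hr
    by_contra hcon
    apply p.2
    apply MvPolynomial.map_injective (algebraMap ℚ ℝ) (algebraMap ℚ ℝ).injective
    refine MvPolynomial.funext_set (fun i => Metric.ball (x i) r) (fun i => ?_) ?_
    · rw [Real.ball_eq_Ioo]
      exact Set.Ioo_infinite (by linarith)
    · intro y hy
      by_contra hne
      refine hcon ⟨y, ?_, ?_⟩
      · rw [ball_pi _ hr]; exact hy
      · simpa [MvPolynomial.eval_map, MvPolynomial.aeval_def] using hne

/-- Universal identification sequences: for `m > 2L` there is a dense set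
`S ⊆ (ℝ^t)^m` each of whose elements is an identification sequence for the
Zariski closure of every `ℚ`-constructible object class of `t`-variate
polynomial functions admitting a `ℚ`-definable holomorphic encoding by a data
structure of size `L`. -/
theorem universal_identification_sequences (t L m : ℕ)
    (ht : 1 ≤ t) (hL : 1 ≤ L) (hm : 2 * L < m) :
    ∃ S : Set (Fin m → Fin t → ℝ), Dense S ∧
      ∀ γ ∈ S, ∀ D : Set (Fin L → ℂ),
        InBoolAlg
          {Z : Set (Fin L → ℂ) |
            ∃ g : MvPolynomial (Fin L) ℚ, Z = {c | MvPolynomial.aeval c g = 0}} D →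
        ∀ (Δ : ℕ) (Ω : (Fin t → Fin (Δ + 1)) → MvPolynomial (Fin L) ℚ),
          (∀ α : Fin t → Fin (Δ + 1), Δ < ∑ i : Fin t, (α i : ℕ) → Ω α = 0) →
          ∀ v₁ ∈ zClosure (objClass t L Δ D Ω), ∀ v₂ ∈ zClosure (objClass t L Δ D Ω),
            (∀ i : Fin m,
              evalVec v₁ (fun j => ((γ i j : ℝ) : ℂ)) =
                evalVec v₂ (fun j => ((γ i j : ℝ) : ℂ))) → v₁ = v₂ := by
  classical
  refine ⟨{γ | AlgebraicIndependent ℚ (fun p : Fin m × Fin t => γ p.1 p.2)}, ?_, ?_⟩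
  · have hd := aux_dense (Fin m × Fin t)
    let f : (Fin m × Fin t → ℝ) → (Fin m → Fin t → ℝ) := fun x i j => x (i, j)
    have hf : Continuous f := by fun_prop
    have hs : Function.Surjective f := fun y => ⟨fun p => y p.1 p.2, rfl⟩
    refine (hs.denseRange.dense_image hf hd).mono ?_
    rintro _ ⟨x, hx, rfl⟩
    exact hx
  intro γ hγ D _ Δ Ω _ v₁ hv₁ v₂ hv₂ heq
  by_contra hne
  let M := AlgebraicIndependent.matroid ℚ ℂ
  let g : Fin m × Fin t → ℂ := fun p => ((γ p.1 p.2 : ℝ) : ℂ)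
  have hg : AlgebraicIndependent ℚ g :=
    AlgebraicIndependent.map' (f := IsScalarTower.toAlgHom ℚ ℝ ℂ) hγ Complex.ofReal_injective
  have hgi : Function.Injective g := hg.injective
  have hG : M.Indep (Set.range g) := (algebraicIndependent_subtype_range hgi).2 hg
  let X : Set ℂ := Set.range v₁ ∪ Set.range v₂
  have hj : ∀ i : Fin m, ∃ j, g (i, j) ∈ M.closure (X ∪ (fun j => g (i, j)) '' {j}ᶜ) := by
    intro i
    refine aux_dep t Δ (v₁ - v₂) (sub_ne_zero.2 hne) (fun j => g (i, j)) ?_ ?_ X ?_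
    · intro a b h
      exact (Prod.mk.inj (hgi h)).2
    · have h := sub_eq_zero.2 (heq i)
      rw [← h]
      simp only [evalVec, Pi.sub_apply, sub_mul, Finset.sum_sub_distrib, g]
    · intro a
      exact sub_mem (Algebra.subset_adjoin (Or.inl ⟨a, rfl⟩))
        (Algebra.subset_adjoin (Or.inr ⟨a, rfl⟩))
  choose j hj using hj
  let R : Finset (Fin m × Fin t) := Finset.univ.image fun i => (i, j i)
  have hR : R.card = m := by
    rw [Finset.card_image_of_injective _ fun a b h => (Prod.mk.inj h).1]
    simp
  have hRc : Rᶜ.card + m = m * t := by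
    have := Finset.card_add_card_compl R
    simp only [Fintype.card_prod, Fintype.card_fin] at this
    omega
  have hsub : Set.range g ⊆ M.closure (X ∪ g '' (Rᶜ : Finset _)) := by
    rintro _ ⟨⟨i, k⟩, rfl⟩
    by_cases hk : k = j i
    · subst hk
      refine M.closure_subset_closure (Set.union_subset_union_right _ ?_) (hj i)
      rintro _ ⟨k, hk, rfl⟩
      refine ⟨(i, k), ?_, rfl⟩
      simp only [R, Finset.coe_compl, Set.mem_compl_iff, Finset.mem_coe, Finset.mem_image,
        Finset.mem_univ, true_and, not_exists, Prod.mk.injEq, not_and]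
      rintro a rfl h
      exact hk h.symm
    · refine M.subset_closure _ (Set.subset_univ _) (Or.inr ⟨(i, k), ?_, rfl⟩)
      simp only [R, Finset.coe_compl, Set.mem_compl_iff, Finset.mem_coe, Finset.mem_image,
        Finset.mem_univ, true_and, not_exists, Prod.mk.injEq, not_and]
      rintro a rfl h
      exact hk h.symm
  have h1 : (Set.range g).encard ≤ (L + L : ℕ∞) + (Rᶜ.card : ℕ∞) := by
    calc (Set.range g).encard ≤ M.eRk (M.closure (X ∪ g '' (Rᶜ : Finset _))) :=
          hG.encard_le_eRk_of_subset hsub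
      _ = M.eRk (X ∪ g '' (Rᶜ : Finset _)) := M.eRk_closure_eq _
      _ ≤ M.eRk X + (g '' (Rᶜ : Finset _)).encard := M.eRk_union_le_eRk_add_encard _ _
      _ ≤ (L + L : ℕ∞) + (Rᶜ.card : ℕ∞) := by
          refine add_le_add ((M.eRk_union_le_eRk_add_eRk _ _).trans
            (add_le_add (aux_rank t L Δ D Ω v₁ hv₁) (aux_rank t L Δ D Ω v₂ hv₂))) ?_
          refine (Set.encard_image_le _ _).trans ?_
          rw [Set.encard_coe_eq_coe_finsetCard]
  have h2 : (Set.range g).encard = ((m * t : ℕ) : ℕ∞) := by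
    rw [← Set.image_univ, hgi.encard_image, Set.encard_univ]
    simp
  rw [h2] at h1
  have h3 : m * t ≤ L + L + Rᶜ.card := by exact_mod_cast h1
  omega
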